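/- There exist absolute constants c, C > 0 with the following property. Let N, M, Q be positive integers with Q ≥ 2, let K ⊆ ℝ^N be a closed set, let f_Q be a Q-level quantizer, and let x ∈ ℝ^N be nonzero. Define μ_p = E[f_Q(‖x‖₂ g) g], σ_p² = E[(f_Q(‖x‖₂ g) − μ_p g)²], and η_p² = E[(f_Q(‖x‖₂ g) − μ_p g)² g²]. Assume μ_p·(x/‖x‖₂) ∈ K, set d(K) = w(D(K, μ_p·(x/‖x‖₂)))², and assume M ≥ c·d(K). Then with probability at least 0.99 over the Gaussian measurement matrix Φ, every K-Lasso solution x' computed from y_i = f_Q((Φx)_i) satisfies ‖x' − μ_p·(x/‖x‖₂)‖₂ ≤ C·( √(d(K))·σ_p + η_p )/√M. -/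

import Mathlib

noncomputable section
open MeasureTheory ProbabilityTheory Real Set

/-- The standard Gaussian measure on `ℝ`. -/
def stdGauss : Measure ℝ := gaussianReal 0 1

instance : IsProbabilityMeasure stdGauss := by unfold stdGauss; infer_instance

/-- A `Q`-level quantizer: thresholds `-∞ = τ₁ < τ₂ < … < τ_{Q+1} = +∞` (indexed here by
`Fin (Q+1)`, so `τ 0 = ⊥` and `τ (Fin.last Q) = ⊤`) and values `m₁, …, m_Q`, with the
step function `f` equal to `m i` on the cell `[τ i, τ (i+1))`. -/
structure Quantizer (Q : ℕ) where
  m : Fin Q → ℝ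
  τ : Fin (Q + 1) → EReal
  f : ℝ → ℝ
  τ_bot : τ 0 = ⊥
  τ_top : τ (Fin.last Q) = ⊤
  τ_mono : StrictMono τ
  f_eq : ∀ (i : Fin Q) (t : ℝ), τ i.castSucc ≤ (t : EReal) → (t : EReal) < τ i.succ → f t = m i

/-- The `i`-th quantization cell `[τ_i, τ_{i+1})` (as a subset of `ℝ`). -/
def Quantizer.cell {Q : ℕ} (q : Quantizer Q) (i : Fin Q) : Set ℝ :=
  {t : ℝ | q.τ i.castSucc ≤ (t : EReal) ∧ (t : EReal) < q.τ i.succ}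

/-- The mean squared error `E[(f_Q(g) - g)²]` of a quantizer. -/
def MSE {Q : ℕ} (q : Quantizer Q) : ℝ := ∫ t, (q.f t - t) ^ 2 ∂stdGauss

/-- Euclidean (ℓ²) norm on `ℝ^n`. -/
def l2 {n : ℕ} (v : Fin n → ℝ) : ℝ := Real.sqrt (∑ i, v i ^ 2)

/-- Euclidean inner product on `ℝ^n`. -/
def ip {n : ℕ} (u v : Fin n → ℝ) : ℝ := ∑ i, u i * v i

/-- Standard Gaussian vector measure on `ℝ^n` (i.i.d. standard normal coordinates). -/
def gaussVec (n : ℕ) : Measure (Fin n → ℝ) := Measure.pi fun _ => stdGauss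

/-- Gaussian mean width `w(S) = E sup_{z ∈ S ∩ B₂^n} ⟨z, g⟩`. -/
def meanWidth {n : ℕ} (S : Set (Fin n → ℝ)) : ℝ :=
  ∫ g, sSup ((fun z => ip z g) '' (S ∩ {z | l2 z ≤ 1})) ∂(gaussVec n)

/-- Tangent cone `D(K, u) = {t • h : t ≥ 0, h ∈ K - u}`. -/
def tangentCone {n : ℕ} (K : Set (Fin n → ℝ)) (u : Fin n → ℝ) : Set (Fin n → ℝ) :=
  {v | ∃ t : ℝ, 0 ≤ t ∧ ∃ k ∈ K, v = t • (k - u)}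

/-- Matrix–vector multiplication. -/
def mulVec' {M N : ℕ} (Φ : Fin M → Fin N → ℝ) (x : Fin N → ℝ) : Fin M → ℝ :=
  fun i => ∑ j, Φ i j * x j

/-- Law of an `M × N` random matrix with i.i.d. standard Gaussian entries. -/
def matGauss (M N : ℕ) : Measure (Fin M → Fin N → ℝ) :=
  Measure.pi fun _ => Measure.pi fun _ => stdGauss

/-- `x'` is a `K`-Lasso solution for measurements `y`: it minimizes `‖Φ z - y‖₂` over `z ∈ K`. -/
def IsLassoSol {M N : ℕ} (K : Set (Fin N → ℝ)) (Φ : Fin M → Fin N → ℝ)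
    (y : Fin M → ℝ) (x' : Fin N → ℝ) : Prop :=
  x' ∈ K ∧ ∀ z ∈ K, l2 (mulVec' Φ x' - y) ≤ l2 (mulVec' Φ z - y)

lemma ip_add_left {n : ℕ} (u v w : Fin n → ℝ) : ip (u + v) w = ip u w + ip v w := by
  simp [ip, add_mul, Finset.sum_add_distrib]

lemma ip_smul_left {n : ℕ} (a : ℝ) (u v : Fin n → ℝ) : ip (a • u) v = a * ip u v := by
  simp [ip, Finset.mul_sum, mul_assoc]

lemma ip_comm {n : ℕ} (u v : Fin n → ℝ) : ip u v = ip v u := by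
  simp [ip, mul_comm]

lemma ip_add_right {n : ℕ} (u v w : Fin n → ℝ) : ip u (v + w) = ip u v + ip u w := by
  simp [ip, mul_add, Finset.sum_add_distrib]

lemma ip_smul_right {n : ℕ} (a : ℝ) (u v : Fin n → ℝ) : ip u (a • v) = a * ip u v := by
  rw [ip_comm, ip_smul_left, ip_comm]

lemma ip_sub_left {n : ℕ} (u v w : Fin n → ℝ) : ip (u - v) w = ip u w - ip v w := by
  simp [ip, sub_mul, Finset.sum_sub_distrib]

lemma ip_sub_right {n : ℕ} (u v w : Fin n → ℝ) : ip u (v - w) = ip u v - ip u w := by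
  simp [ip, mul_sub, Finset.sum_sub_distrib]

lemma ip_sum_right {n : ℕ} {ι : Type*} (s : Finset ι) (u : Fin n → ℝ) (v : ι → Fin n → ℝ) :
    ip u (∑ i ∈ s, v i) = ∑ i ∈ s, ip u (v i) := by
  simp only [ip, Finset.sum_apply, Finset.mul_sum]
  exact Finset.sum_comm

lemma l2_nonneg {n : ℕ} (v : Fin n → ℝ) : 0 ≤ l2 v := Real.sqrt_nonneg _

lemma l2_sq {n : ℕ} (v : Fin n → ℝ) : l2 v ^ 2 = ip v v := by
  rw [l2, Real.sq_sqrt (by positivity)]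
  simp [ip, sq]

lemma l2_smul {n : ℕ} (a : ℝ) (v : Fin n → ℝ) : l2 (a • v) = |a| * l2 v := by
  simp only [l2, Pi.smul_apply, smul_eq_mul, mul_pow, ← Finset.mul_sum]
  rw [Real.sqrt_mul (sq_nonneg a), Real.sqrt_sq_eq_abs]

lemma l2_pos {n : ℕ} {v : Fin n → ℝ} (hv : v ≠ 0) : 0 < l2 v := by
  obtain ⟨i, hi⟩ := Function.ne_iff.1 hv
  refine Real.sqrt_pos.2 (Finset.sum_pos' (fun _ _ => sq_nonneg _) ⟨i, Finset.mem_univ _, ?_⟩)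
  have : v i ≠ 0 := hi
  positivity

lemma abs_ip_le {n : ℕ} (u v : Fin n → ℝ) : |ip u v| ≤ l2 u * l2 v := by
  rw [← sq_le_sq₀ (abs_nonneg _) (mul_nonneg (l2_nonneg u) (l2_nonneg v)), sq_abs, mul_pow, l2, l2,
    Real.sq_sqrt (by positivity), Real.sq_sqrt (by positivity)]
  exact Finset.sum_mul_sq_le_sq_mul_sq _ _ _

lemma continuous_ip {n : ℕ} {α : Type*} [TopologicalSpace α] {f g : α → Fin n → ℝ}
    (hf : Continuous f) (hg : Continuous g) : Continuous fun a => ip (f a) (g a) := by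
  unfold ip; fun_prop

lemma continuous_l2 {n : ℕ} : Continuous (l2 : (Fin n → ℝ) → ℝ) := by
  unfold l2; fun_prop

@[fun_prop]
lemma measurable_ip {n : ℕ} {α : Type*} [MeasurableSpace α] {f g : α → Fin n → ℝ}
    (hf : Measurable f) (hg : Measurable g) : Measurable fun a => ip (f a) (g a) := by
  unfold ip; fun_prop

instance (n : ℕ) : IsProbabilityMeasure (gaussVec n) := by unfold gaussVec; infer_instance

instance (M N : ℕ) : IsProbabilityMeasure (matGauss M N) := by unfold matGauss; infer_instance

lemma matGauss_eq (M N : ℕ) : matGauss M N = Measure.pi fun _ => gaussVec N := rfl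

lemma charFunDual_stdGauss (L : StrongDual ℝ ℝ) :
    charFunDual stdGauss L = Complex.exp ((-(L 1) ^ 2 / 2 : ℝ)) := by
  rw [charFunDual_eq_charFun_map_one]
  have h : ⇑L = fun t => L 1 * t := by
    ext t
    have := L.map_smul t 1
    simp only [smul_eq_mul, mul_one] at this
    rw [this, mul_comm]
  rw [h, stdGauss, gaussianReal_map_const_mul, charFun_gaussianReal]
  congr 1
  push_cast
  simp
  ring

lemma charFunDual_gaussVec {n : ℕ} (L : StrongDual ℝ (Fin n → ℝ)) :
    charFunDual (gaussVec n) L =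
      Complex.exp ((-(∑ j, (L (Pi.single j 1)) ^ 2) / 2 : ℝ)) := by
  rw [gaussVec, charFunDual_pi]
  simp_rw [charFunDual_stdGauss]
  rw [← Complex.exp_sum, ← Complex.ofReal_sum]
  congr 2
  simp [neg_div, Finset.sum_div, Finset.sum_neg_distrib]

lemma dual_apply_eq_ip {n : ℕ} (L : StrongDual ℝ (Fin n → ℝ)) (v : Fin n → ℝ) :
    L v = ip v fun j => L (Pi.single j 1) := by
  conv_lhs => rw [pi_eq_sum_univ' v, map_sum]
  simp [ip, map_smul]

/-- The reflection of `ℝ^n × ℝ` exchanging the unit vector `p` with the last basis vector. -/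
def swapUnit {n : ℕ} (p : Fin n → ℝ) (z : (Fin n → ℝ) × ℝ) : (Fin n → ℝ) × ℝ :=
  (z.1 - ip z.1 p • p + z.2 • p, ip z.1 p)

lemma measurePreserving_swapUnit {n : ℕ} {p : Fin n → ℝ} (hp : ip p p = 1) :
    MeasurePreserving (swapUnit p) ((gaussVec n).prod stdGauss)
      ((gaussVec n).prod stdGauss) := by
  have hlin : ∃ A : (Fin n → ℝ) × ℝ →L[ℝ] (Fin n → ℝ) × ℝ, ⇑A = swapUnit p := by
    refine ⟨LinearMap.toContinuousLinearMap
      { toFun := swapUnit p, map_add' := fun a b => ?_, map_smul' := fun a b => ?_ }, rfl⟩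
    · ext <;> simp [swapUnit, ip_add_left]
      ring
    · ext <;> simp [swapUnit, ip_smul_left]
      ring
  obtain ⟨A, hA⟩ := hlin
  rw [← hA]
  refine ⟨A.continuous.measurable, Measure.ext_of_charFunDual (funext fun L => ?_)⟩
  rw [charFunDual_map, charFunDual_prod, charFunDual_prod]
  simp only [charFunDual_gaussVec, charFunDual_stdGauss, ← Complex.exp_add, ← Complex.ofReal_add]
  congr 2
  set l : Fin n → ℝ := fun j => L (Pi.single j 1, 0) with hl
  set r := L (0, 1) with hr
  have hL : ∀ v s, L (v, s) = ip v l + s * r := by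
    intro v s
    have h1 : L (v, s) = L (v, 0) + s * L (0, 1) := by
      rw [← smul_eq_mul, ← map_smul, ← map_add]; simp
    rw [h1, show L (v, 0) = (L.comp (ContinuousLinearMap.inl ℝ _ _)) v by simp, dual_apply_eq_ip]
    simp [hl, hr]
  have hsingle : ∀ j (q : Fin n → ℝ), ip (Pi.single j 1) q = q j := by
    intro j q; simp [ip, Pi.single_apply]
  have e1 : ∀ j, (L.comp A) (Pi.single j 1, 0) = l j - p j * ip p l + p j * r := by
    intro j
    simp [hA, swapUnit, hL, ip_sub_left, ip_smul_left, hsingle]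
  have e2 : (L.comp A) (0, 1) = ip p l := by
    simp [hA, swapUnit, hL, ip]
  have e3 : ∑ j, (l j - p j * ip p l + p j * r) ^ 2 = ∑ j, l j ^ 2 + r ^ 2 - ip p l ^ 2 := by
    have : ∀ j, (l j - p j * ip p l + p j * r) ^ 2 =
        l j ^ 2 + (2 * (r - ip p l)) * (p j * l j) + (r - ip p l) ^ 2 * (p j * p j) := by
      intro j; ring
    simp_rw [this, Finset.sum_add_distrib, ← Finset.mul_sum]
    change _ + _ * ip p l + _ * ip p p = _
    rw [hp]; ring
  simp only [ContinuousLinearMap.comp_apply, ContinuousLinearMap.inl_apply,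
    ContinuousLinearMap.inr_apply] at e1 e2 ⊢
  simp only [e1, e2, e3]
  simp only [hl, hr]
  ring

lemma gaussVec_map_ip {n : ℕ} (v : Fin n → ℝ) :
    (gaussVec n).map (ip v) = stdGauss.map (fun t => l2 v * t) := by
  have hlin : ∃ A : (Fin n → ℝ) →L[ℝ] ℝ, ⇑A = ip v := by
    refine ⟨LinearMap.toContinuousLinearMap
      { toFun := ip v, map_add' := fun a b => ?_, map_smul' := fun a b => ?_ }, rfl⟩
    · simp [ip_add_right]
    · simp [ip_smul_right]
  obtain ⟨A, hA⟩ := hlin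
  have hB : ⇑(l2 v • ContinuousLinearMap.id ℝ ℝ) = fun t => l2 v * t := by ext; simp
  have := Measure.isProbabilityMeasure_map (μ := gaussVec n) A.continuous.aemeasurable
  have := Measure.isProbabilityMeasure_map (μ := stdGauss)
    (l2 v • ContinuousLinearMap.id ℝ ℝ).continuous.aemeasurable
  rw [← hA, ← hB]
  refine Measure.ext_of_charFunDual (funext fun L => ?_)
  rw [charFunDual_map, charFunDual_map, charFunDual_gaussVec, charFunDual_stdGauss]
  congr 3
  have hL : ∀ t, L t = t * L 1 := fun t => by rw [← smul_eq_mul, ← map_smul]; simp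
  simp only [ContinuousLinearMap.comp_apply, hA, hB]
  have h1 : ∀ j, ip v (Pi.single j 1) = v j := by
    intro j; simp [ip, Pi.single_apply]
  simp only [h1]
  rw [hL (l2 v * 1)]
  simp_rw [fun j => hL (v j), mul_pow, ← Finset.sum_mul]
  rw [l2, one_pow, mul_one, Real.sq_sqrt (by positivity)]

lemma matGauss_map_weighted_sum {M N : ℕ} (z : Fin M → ℝ) :
    (matGauss M N).map (fun Φ => ∑ m, z m • Φ m) = (gaussVec N).map (fun g => l2 z • g) := by
  have hlin : ∃ A : (Fin M → Fin N → ℝ) →L[ℝ] (Fin N → ℝ), ⇑A = fun Φ => ∑ m, z m • Φ m := by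
    refine ⟨LinearMap.toContinuousLinearMap
      { toFun := fun Φ => ∑ m, z m • Φ m, map_add' := fun a b => ?_,
        map_smul' := fun a b => ?_ }, rfl⟩
    · simp [Finset.sum_add_distrib]
    · simp [Finset.smul_sum, smul_comm a]
  obtain ⟨A, hA⟩ := hlin
  have hB : ⇑(l2 z • ContinuousLinearMap.id ℝ (Fin N → ℝ)) = fun t => l2 z • t := by ext; simp
  have := Measure.isProbabilityMeasure_map (μ := matGauss M N) A.continuous.aemeasurable
  have := Measure.isProbabilityMeasure_map (μ := gaussVec N)
    (l2 z • ContinuousLinearMap.id ℝ (Fin N → ℝ)).continuous.aemeasurable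
  rw [← hA, ← hB]
  refine Measure.ext_of_charFunDual (funext fun L => ?_)
  rw [charFunDual_map, charFunDual_map, charFunDual_gaussVec, matGauss_eq, charFunDual_pi]
  simp_rw [charFunDual_gaussVec]
  rw [← Complex.exp_sum, ← Complex.ofReal_sum]
  congr 2
  simp only [ContinuousLinearMap.comp_apply, hA, hB, map_smul, ContinuousLinearMap.single_apply]
  have h1 : ∀ m j, ∑ k, z k • (Pi.single m (Pi.single j (1 : ℝ)) : Fin M → Fin N → ℝ) k
      = z m • (Pi.single j (1 : ℝ) : Fin N → ℝ) := by
    intro m j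
    rw [Finset.sum_eq_single m] <;> simp +contextual
  simp only [h1, map_smul, smul_eq_mul, mul_pow, ← Finset.mul_sum]
  rw [l2, Real.sq_sqrt (by positivity), Finset.sum_mul, neg_div, Finset.sum_div,
    ← Finset.sum_neg_distrib]
  exact Finset.sum_congr rfl fun i _ => by ring

open scoped ENNReal in
/-- The supremum over `n` of the positive part of `a n`. -/
def posSup (a : ℕ → ℝ) : ℝ≥0∞ := ⨆ n, ENNReal.ofReal (a n)

lemma ofReal_le_posSup (a : ℕ → ℝ) (n : ℕ) : ENNReal.ofReal (a n) ≤ posSup a :=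
  le_iSup (fun n => ENNReal.ofReal (a n)) n

lemma posSup_const_mul {r : ℝ} (hr : 0 ≤ r) (a : ℕ → ℝ) :
    posSup (fun n => r * a n) = ENNReal.ofReal r * posSup a := by
  simp [posSup, ENNReal.ofReal_mul hr, ENNReal.mul_iSup]

@[fun_prop]
lemma measurable_posSup {α : Type*} [MeasurableSpace α] {a : α → ℕ → ℝ}
    (ha : Measurable a) : Measurable fun x => posSup (a x) := by
  unfold posSup
  refine Measurable.iSup fun n => ?_
  fun_prop

/-- Jensen's inequality for `posSup`. -/
lemma posSup_integral_le {α : Type*} [MeasurableSpace α] {μ : Measure α}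
    {a : α → ℕ → ℝ} (ha : ∀ n, Integrable (fun x => a x n) μ) :
    posSup (fun n => ∫ x, a x n ∂μ) ≤ ∫⁻ x, posSup (a x) ∂μ := by
  refine (iSup_mono fun n => ?_).trans (iSup_lintegral_le _)
  have hpos : Integrable (fun x => max (a x n) 0) μ := (ha n).pos_part
  calc ENNReal.ofReal (∫ x, a x n ∂μ) ≤ ENNReal.ofReal (∫ x, max (a x n) 0 ∂μ) :=
        ENNReal.ofReal_le_ofReal (integral_mono (ha n) hpos fun x => le_max_left _ _)
    _ = ∫⁻ x, ENNReal.ofReal (max (a x n) 0) ∂μ :=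
        ofReal_integral_eq_lintegral_ofReal hpos (ae_of_all _ fun x => le_max_right _ _)
    _ = ∫⁻ x, ENNReal.ofReal (a x n) ∂μ := by simp [ENNReal.ofReal_max]

lemma lintegral_pi_succ_posSup {X : Type*} [MeasurableSpace X] (μ : Measure X)
    [IsProbabilityMeasure μ] (F : X → ℕ → ℝ) (a : ℕ → ℝ) (M : ℕ) :
    ∫⁻ x, posSup (a + ∑ m, F (x m)) ∂(Measure.pi fun _ : Fin (M + 1) => μ) =
      ∫⁻ p, posSup (a + F p.1 + ∑ m, F (p.2 m)) ∂(μ.prod (Measure.pi fun _ : Fin M => μ)) := by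
  rw [← (measurePreserving_piFinSuccAbove (fun _ : Fin (M + 1) => μ) 0).lintegral_comp_emb
    (MeasurableEquiv.measurableEmbedding _)]
  refine lintegral_congr fun x => ?_
  simp [Fin.sum_univ_succ, add_assoc, Fin.tail]

/-- A comparison of expected suprema that holds for one summand under every deterministic shift
holds for sums of independent copies. -/
lemma lintegral_posSup_sum_le {X Y : Type*} [MeasurableSpace X] [MeasurableSpace Y]
    (μ : Measure X) (ν : Measure Y) [IsProbabilityMeasure μ] [IsProbabilityMeasure ν]
    {F : X → ℕ → ℝ} {G : Y → ℕ → ℝ} (hF : Measurable F) (hG : Measurable G)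
    (h : ∀ a : ℕ → ℝ, ∫⁻ x, posSup (a + F x) ∂μ ≤ ∫⁻ y, posSup (a + G y) ∂ν) (M : ℕ) :
    ∀ a : ℕ → ℝ, ∫⁻ x, posSup (a + ∑ m, F (x m)) ∂(Measure.pi fun _ : Fin M => μ) ≤
      ∫⁻ y, posSup (a + ∑ m, G (y m)) ∂(Measure.pi fun _ : Fin M => ν) := by
  induction M with
  | zero => intro a; simp
  | succ M ih =>
    intro a
    rw [lintegral_pi_succ_posSup, lintegral_pi_succ_posSup, lintegral_prod _ (by fun_prop), lintegral_prod_symm' _ (by fun_prop)]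
    calc ∫⁻ x, ∫⁻ x', posSup (a + F x + ∑ m, F (x' m)) ∂(Measure.pi fun _ : Fin M => μ) ∂μ
        ≤ ∫⁻ x, ∫⁻ y', posSup (a + F x + ∑ m, G (y' m)) ∂(Measure.pi fun _ : Fin M => ν) ∂μ :=
          lintegral_mono fun x => ih (a + F x)
      _ = ∫⁻ y', ∫⁻ x, posSup (a + F x + ∑ m, G (y' m)) ∂μ ∂(Measure.pi fun _ : Fin M => ν) :=
          lintegral_lintegral_swap (by fun_prop)
      _ ≤ _ := lintegral_mono fun y' => by
          simpa only [add_right_comm a (∑ m, G (y' m))] using h (a + ∑ m, G (y' m))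

lemma fun_sum_apply_eq {Z : Type*} {M : ℕ} (H : Z → ℕ → ℝ) (z : Fin M → Z) :
    (fun n => ∑ m, H (z m) n) = 0 + ∑ m, H (z m) := by
  ext n; simp

lemma lintegral_posSup_sum_le_of_row {X Y : Type*} [MeasurableSpace X] [MeasurableSpace Y]
    (μ : Measure X) (ν : Measure Y) [IsProbabilityMeasure μ] [IsProbabilityMeasure ν]
    {F : X → ℕ → ℝ} {G : Y → ℕ → ℝ} (hF : Measurable F) (hG : Measurable G)
    (h : ∀ a : ℕ → ℝ, ∫⁻ x, posSup (fun n => a n + F x n) ∂μ ≤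
      ∫⁻ y, posSup (fun n => a n + G y n) ∂ν) (M : ℕ) :
    ∫⁻ x, posSup (fun n => ∑ m, F (x m) n) ∂(Measure.pi fun _ : Fin M => μ) ≤
      ∫⁻ y, posSup (fun n => ∑ m, G (y m) n) ∂(Measure.pi fun _ : Fin M => ν) := by
  simp only [fun_sum_apply_eq F, fun_sum_apply_eq G]
  exact lintegral_posSup_sum_le μ ν hF hG h M 0

/-- Contraction by the absolute value, for one symmetric pair. -/
lemma posSup_add_abs_le (a b : ℕ → ℝ) :
    posSup (fun n => a n + |b n|) + posSup (fun n => a n - |b n|) ≤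
      posSup (fun n => a n + b n) + posSup (fun n => a n - b n) := by
  have hp := ofReal_le_posSup (fun n => a n + b n)
  have hm := ofReal_le_posSup (fun n => a n - b n)
  refine ENNReal.iSup_add_iSup_le fun i j => ?_
  change ENNReal.ofReal (a i + |b i|) + ENNReal.ofReal (a j - |b j|) ≤ _
  rcases le_or_gt (a j - |b j|) 0 with hj | hj
  · rw [ENNReal.ofReal_of_nonpos hj, add_zero]
    rcases abs_cases (b i) with h | h <;> rw [h.1]
    · exact (hp i).trans le_self_add
    · exact (hm i).trans le_add_self
  rcases le_or_gt (a i + |b i|) 0 with hi | hi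
  · rw [ENNReal.ofReal_of_nonpos hi, zero_add]
    exact (ENNReal.ofReal_le_ofReal (by linarith [neg_abs_le (b j)])).trans
      ((hp j).trans le_self_add)
  rw [← ENNReal.ofReal_add hi.le hj.le]
  rcases le_total 0 (b i) with h | h
  · refine le_trans ?_ (add_le_add (hp i) (hm j))
    rw [abs_of_nonneg h]
    exact (ENNReal.ofReal_le_ofReal (by linarith [le_abs_self (b j)])).trans
      ENNReal.ofReal_add_le
  · refine le_trans ?_ (add_le_add (hp j) (hm i))
    rw [abs_of_nonpos h]
    exact (ENNReal.ofReal_le_ofReal (by linarith [neg_abs_le (b j)])).trans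
      ENNReal.ofReal_add_le

/-- Convexity of `posSup`. -/
lemma posSup_add_sub_le (a p q : ℕ → ℝ) :
    posSup (fun n => a n + p n - q n) ≤
      ENNReal.ofReal 2⁻¹ * (posSup (fun n => a n + 2 * p n) + posSup (fun n => a n - 2 * q n)) := by
  refine iSup_le fun n => ?_
  refine le_trans ?_ (mul_le_mul_right (add_le_add
    (ofReal_le_posSup (fun n => a n + 2 * p n) n) (ofReal_le_posSup (fun n => a n - 2 * q n) n)) _)
  rw [mul_add, ← ENNReal.ofReal_mul (by norm_num), ← ENNReal.ofReal_mul (by norm_num)]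
  refine le_trans (ENNReal.ofReal_le_ofReal ?_) ENNReal.ofReal_add_le
  linarith

/-- One-row symmetrization and contraction for a symmetric law. -/
lemma lintegral_posSup_abs_le {X : Type*} [MeasurableSpace X] (μ : Measure X)
    [IsProbabilityMeasure μ] {L : X → ℕ → ℝ} (hL : Measurable L)
    (hint : ∀ n, Integrable (fun x => L x n) μ)
    (hsymm : ∀ a : ℕ → ℝ, ∫⁻ x, posSup (fun n => a n - 2 * L x n) ∂μ =
      ∫⁻ x, posSup (fun n => a n + 2 * L x n) ∂μ) (a : ℕ → ℝ) :
    ∫⁻ x, posSup (fun n => a n + ((∫ x', |L x' n| ∂μ) - |L x n|)) ∂μ ≤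
      ∫⁻ x, posSup (fun n => a n + 2 * L x n) ∂μ := by
  have hLn : ∀ n, Measurable fun x => L x n := fun n => (measurable_pi_apply n).comp hL
  have m1 : Measurable fun x => posSup (fun n => a n + 2 * |L x n|) :=
    measurable_posSup (measurable_pi_iff.2 fun n => by have := hLn n; fun_prop)
  have m2 : Measurable fun x => posSup (fun n => a n - 2 * |L x n|) :=
    measurable_posSup (measurable_pi_iff.2 fun n => by have := hLn n; fun_prop)
  have m3 : Measurable fun x => posSup (fun n => a n + 2 * L x n) :=
    measurable_posSup (measurable_pi_iff.2 fun n => by have := hLn n; fun_prop)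
  calc ∫⁻ x, posSup (fun n => a n + ((∫ x', |L x' n| ∂μ) - |L x n|)) ∂μ
      ≤ ∫⁻ x, ∫⁻ x', posSup (fun n => a n + |L x' n| - |L x n|) ∂μ ∂μ := by
        refine lintegral_mono fun x => ?_
        refine le_of_eq_of_le ?_ (posSup_integral_le fun n => ?_)
        · congr 1; ext n
          rw [integral_sub, integral_add, integral_const, integral_const]
          · simp [add_sub_assoc]
          · fun_prop
          · exact (hint n).abs
          · exact (integrable_const _).add (hint n).abs
          · fun_prop
        · exact ((integrable_const _).add (hint n).abs).sub (integrable_const _)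
    _ ≤ ∫⁻ x, ∫⁻ x', ENNReal.ofReal 2⁻¹ * (posSup (fun n => a n + 2 * |L x' n|) +
          posSup (fun n => a n - 2 * |L x n|)) ∂μ ∂μ :=
        lintegral_mono fun x => lintegral_mono fun x' => posSup_add_sub_le _ _ _
    _ = ENNReal.ofReal 2⁻¹ * ((∫⁻ x, posSup (fun n => a n + 2 * |L x n|) ∂μ) +
          ∫⁻ x, posSup (fun n => a n - 2 * |L x n|) ∂μ) := by
        simp_rw [lintegral_const_mul' _ _ ENNReal.ofReal_ne_top, lintegral_add_left m1,
          lintegral_const, measure_univ, mul_one]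
        rw [lintegral_add_left measurable_const]
        simp
    _ = ENNReal.ofReal 2⁻¹ * ∫⁻ x, (posSup (fun n => a n + |2 * L x n|) +
          posSup (fun n => a n - |2 * L x n|)) ∂μ := by
        rw [← lintegral_add_left m1]
        simp [abs_mul]
    _ ≤ ENNReal.ofReal 2⁻¹ * ∫⁻ x, (posSup (fun n => a n + 2 * L x n) +
          posSup (fun n => a n - 2 * L x n)) ∂μ := by
        refine mul_le_mul_right (lintegral_mono fun x => ?_) _
        exact posSup_add_abs_le _ _
    _ = ∫⁻ x, posSup (fun n => a n + 2 * L x n) ∂μ := by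
        rw [lintegral_add_left m3, hsymm, ← two_mul, ← mul_assoc]
        rw [show (2 : ENNReal) = ENNReal.ofReal 2 by simp, ← ENNReal.ofReal_mul (by norm_num)]
        norm_num

lemma gaussVec_neg (n : ℕ) : MeasurePreserving (fun g => -g) (gaussVec n) (gaussVec n) := by
  refine measurePreserving_pi _ _ (f := fun _ t => -t) fun _ => ⟨measurable_neg, ?_⟩
  rw [stdGauss, gaussianReal_map_neg, neg_zero]

lemma integrable_id_stdGauss : Integrable (fun t : ℝ => t) stdGauss :=
  memLp_one_iff_integrable.1 (memLp_id_gaussianReal 1)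

lemma integral_id_stdGauss : ∫ t, t ∂stdGauss = 0 := integral_id_gaussianReal

lemma integrable_ip {n : ℕ} (v : Fin n → ℝ) : Integrable (fun g => ip g v) (gaussVec n) := by
  have h : Integrable (fun s : ℝ => s) ((gaussVec n).map (ip v)) := by
    rw [gaussVec_map_ip, integrable_map_measure (by fun_prop) (by fun_prop)]
    exact integrable_id_stdGauss.const_mul _
  simp_rw [fun g => ip_comm g v]
  exact Integrable.comp_measurable (f := ip v) (g := fun s => s) h (by fun_prop)

lemma integral_abs_ip {n : ℕ} (v : Fin n → ℝ) :
    ∫ g, |ip g v| ∂(gaussVec n) = (∫ t, |t| ∂stdGauss) * l2 v := by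
  have h : ∫ s, |s| ∂((gaussVec n).map (ip v)) = (∫ t, |t| ∂stdGauss) * l2 v := by
    rw [gaussVec_map_ip, integral_map (by fun_prop) (by fun_prop), mul_comm, ← integral_const_mul]
    simp [abs_mul, abs_of_nonneg (l2_nonneg v)]
  rw [← h, integral_map (by fun_prop) (by fun_prop)]
  simp_rw [fun g => ip_comm g v]

lemma integral_abs_stdGauss_pos : 0 < ∫ t, |t| ∂stdGauss := by
  rw [integral_pos_iff_support_of_nonneg (fun t => abs_nonneg t) integrable_id_stdGauss.abs]
  have hsupp : (Function.support fun t : ℝ => |t|) = {0}ᶜ := by ext; simp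
  rw [hsupp, prob_compl_eq_one_sub (measurableSet_singleton _)]
  have : NullSingletonClass stdGauss := nullSingletonClass_gaussianReal one_ne_zero
  simp

/-- The Gaussian width of the sequence `v`, as an extended nonnegative real. -/
def seqWidth {N : ℕ} (v : ℕ → Fin N → ℝ) : ENNReal :=
  ∫⁻ g, posSup (fun n => ip g (v n)) ∂(gaussVec N)

lemma measurable_ip_seq {N : ℕ} (v : ℕ → Fin N → ℝ) :
    Measurable fun (g : Fin N → ℝ) (n : ℕ) => ip g (v n) :=
  measurable_pi_iff.2 fun n => by fun_prop

lemma lintegral_posSup_weighted {M N : ℕ} (v : ℕ → Fin N → ℝ) (z : Fin M → ℝ) :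
    ∫⁻ Φ, posSup (fun n => ∑ m, z m * ip (Φ m) (v n)) ∂(matGauss M N) =
      ENNReal.ofReal (l2 z) * seqWidth v := by
  have h1 : ∀ Φ : Fin M → Fin N → ℝ, posSup (fun n => ∑ m, z m * ip (Φ m) (v n)) =
      posSup fun n => ip (∑ m, z m • Φ m) (v n) := by
    intro Φ
    congr 1; ext n
    rw [ip_comm, ip_sum_right]
    exact Finset.sum_congr rfl fun m _ => by rw [ip_smul_right, ip_comm]
  have hm : Measurable fun g : Fin N → ℝ => posSup fun n => ip g (v n) :=
    measurable_posSup (measurable_ip_seq v)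
  simp_rw [h1]
  rw [← lintegral_map (f := fun g => posSup fun n => ip g (v n)) hm (by fun_prop),
    matGauss_map_weighted_sum, lintegral_map hm (by fun_prop), seqWidth, ← lintegral_const_mul _ hm]
  simp_rw [ip_smul_left, posSup_const_mul (l2_nonneg z)]

lemma l2_const_one (M : ℕ) : l2 (fun _ : Fin M => (1 : ℝ)) = Real.sqrt M := by
  simp [l2]

lemma lintegral_posSup_lower {M N : ℕ} (v : ℕ → Fin N → ℝ) :
    ∫⁻ Φ, posSup (fun n => ∑ m : Fin M,
        ((∫ t, |t| ∂stdGauss) * l2 (v n) - |ip (Φ m) (v n)|)) ∂(matGauss M N) ≤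
      ENNReal.ofReal (2 * Real.sqrt M) * seqWidth v := by
  have hsymm : ∀ a : ℕ → ℝ, ∫⁻ g, posSup (fun n => a n - 2 * ip g (v n)) ∂(gaussVec N) =
      ∫⁻ g, posSup (fun n => a n + 2 * ip g (v n)) ∂(gaussVec N) := by
    intro a
    rw [← (gaussVec_neg N).lintegral_comp]
    · simp [ip]
    · exact measurable_posSup (measurable_pi_iff.2 fun n => by fun_prop)
  have row := lintegral_posSup_abs_le (gaussVec N) (measurable_ip_seq v)
    (fun n => integrable_ip (v n)) hsymm
  simp only [integral_abs_ip] at row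
  have h := lintegral_posSup_sum_le_of_row (gaussVec N) (gaussVec N)
    (F := fun g n => (∫ t, |t| ∂stdGauss) * l2 (v n) - |ip g (v n)|)
    (G := fun g n => 2 * ip g (v n))
    (measurable_pi_iff.2 fun n => by fun_prop) (measurable_pi_iff.2 fun n => by fun_prop)
    row M
  rw [← matGauss_eq] at h
  refine h.trans (le_of_eq ?_)
  simp_rw [← Finset.mul_sum, posSup_const_mul (zero_le_two (α := ℝ))]
  rw [lintegral_const_mul' _ _ ENNReal.ofReal_ne_top]
  have := lintegral_posSup_weighted v (fun _ : Fin M => (1 : ℝ))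
  simp only [one_mul, l2_const_one] at this
  rw [this, ENNReal.ofReal_mul zero_le_two, mul_assoc]

lemma lintegral_posSup_swap_le {N : ℕ} (v : ℕ → Fin N → ℝ) {p : Fin N → ℝ} (hp : ip p p = 1)
    {ξ : ℝ → ℝ} (hξ : Measurable ξ) (a : ℕ → ℝ) :
    ∫⁻ g, posSup (fun n => a n + ξ (ip g p) * (ip g (v n) - ip g p * ip p (v n))) ∂(gaussVec N) ≤
      ∫⁻ y, posSup (fun n => a n + ξ y.2 * ip y.1 (v n)) ∂((gaussVec N).prod stdGauss) := by
  have hm : Measurable fun y : (Fin N → ℝ) × ℝ =>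
      posSup (fun n => a n + ξ y.2 * ip y.1 (v n)) :=
    measurable_posSup (measurable_pi_iff.2 fun n => by fun_prop)
  have hs := measurePreserving_swapUnit hp
  rw [← hs.lintegral_comp hm, lintegral_prod _ (by exact (hm.comp hs.measurable).aemeasurable)]
  refine lintegral_mono fun g => ?_
  simp only [swapUnit, ip_add_left, ip_sub_left, ip_smul_left]
  have hi : ∀ n, Integrable (fun s : ℝ => a n + ξ (ip g p) *
      (ip g (v n) - ip g p * ip p (v n) + s * ip p (v n))) stdGauss := fun n =>
    (integrable_const _).add (((integrable_const _).add
      (integrable_id_stdGauss.mul_const _)).const_mul _)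
  refine le_of_eq_of_le ?_ (posSup_integral_le hi)
  congr 1; ext n
  have e : ∀ s : ℝ, a n + ξ (ip g p) * (ip g (v n) - ip g p * ip p (v n) + s * ip p (v n)) =
      (a n + ξ (ip g p) * (ip g (v n) - ip g p * ip p (v n))) +
        s * (ξ (ip g p) * ip p (v n)) := fun s => by ring
  simp_rw [e]
  rw [integral_add (integrable_const _) (integrable_id_stdGauss.mul_const _), integral_mul_const,
    integral_id_stdGauss]
  simp

lemma integral_l2_comp_le (M : ℕ) {ξ : ℝ → ℝ} (hξ : Measurable ξ)
    (hξ2 : Integrable (fun t => ξ t ^ 2) stdGauss) :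
    ∫⁻ s, ENNReal.ofReal (l2 fun m => ξ (s m)) ∂(gaussVec M) ≤
      ENNReal.ofReal (Real.sqrt M * Real.sqrt (∫ t, ξ t ^ 2 ∂stdGauss)) := by
  have hc : ∀ m : Fin M, Integrable (fun s : Fin M → ℝ => ξ (s m) ^ 2) (gaussVec M) := fun m =>
    (measurePreserving_eval (fun _ : Fin M => stdGauss) m).integrable_comp_of_integrable hξ2
  have hm : Measurable fun s : Fin M → ℝ => l2 fun m => ξ (s m) := by unfold l2; fun_prop
  have hsq : ∀ s : Fin M → ℝ, (l2 fun m => ξ (s m)) ^ 2 = ∑ m, ξ (s m) ^ 2 := fun s => by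
    rw [l2, Real.sq_sqrt (by positivity)]
  have hL : MemLp (fun s : Fin M → ℝ => l2 fun m => ξ (s m)) 2 (gaussVec M) := by
    rw [memLp_two_iff_integrable_sq hm.aestronglyMeasurable]
    simp_rw [hsq]
    exact integrable_finsetSum _ fun m _ => hc m
  rw [← ofReal_integral_eq_lintegral_ofReal (hL.integrable one_le_two)
    (ae_of_all _ fun s => l2_nonneg _)]
  refine ENNReal.ofReal_le_ofReal ?_
  rw [← Real.sqrt_mul (Nat.cast_nonneg _)]
  refine Real.le_sqrt_of_sq_le ?_
  have hv := variance_nonneg (fun s : Fin M → ℝ => l2 fun m => ξ (s m)) (gaussVec M)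
  rw [variance_eq_sub hL] at hv
  have he : ∫ s, (l2 fun m => ξ (s m)) ^ 2 ∂(gaussVec M) = M * ∫ t, ξ t ^ 2 ∂stdGauss := by
    simp_rw [hsq]
    rw [integral_finsetSum _ fun m _ => hc m]
    have : ∀ m : Fin M, ∫ s, ξ (s m) ^ 2 ∂(gaussVec M) = ∫ t, ξ t ^ 2 ∂stdGauss := fun m => by
      have h := (measurePreserving_eval (fun _ : Fin M => stdGauss) m).map_eq
      rw [← h, integral_map (measurable_pi_apply m).aemeasurable
        (Measurable.aestronglyMeasurable (by fun_prop))]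
      rfl
    simp [this]
  rw [← he]
  exact sub_nonneg.1 hv

lemma lintegral_posSup_noise {M N : ℕ} (v : ℕ → Fin N → ℝ) {p : Fin N → ℝ} (hp : ip p p = 1)
    {ξ : ℝ → ℝ} (hξ : Measurable ξ) (hξ2 : Integrable (fun t => ξ t ^ 2) stdGauss) :
    ∫⁻ Φ, posSup (fun n => ∑ m : Fin M,
        ξ (ip (Φ m) p) * (ip (Φ m) (v n) - ip (Φ m) p * ip p (v n))) ∂(matGauss M N) ≤
      ENNReal.ofReal (Real.sqrt M * Real.sqrt (∫ t, ξ t ^ 2 ∂stdGauss)) * seqWidth v := by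
  have h := lintegral_posSup_sum_le_of_row (gaussVec N) ((gaussVec N).prod stdGauss)
    (F := fun g n => ξ (ip g p) * (ip g (v n) - ip g p * ip p (v n)))
    (G := fun y n => ξ y.2 * ip y.1 (v n))
    (measurable_pi_iff.2 fun n => by fun_prop) (measurable_pi_iff.2 fun n => by fun_prop)
    (lintegral_posSup_swap_le v hp hξ) M
  rw [← matGauss_eq] at h
  refine h.trans ?_
  have hmp := measurePreserving_arrowProdEquivProdArrow (Fin N → ℝ) ℝ (Fin M)
    (fun _ => gaussVec N) (fun _ => stdGauss)
  have hm : Measurable fun q : (Fin M → Fin N → ℝ) × (Fin M → ℝ) =>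
      posSup (fun n => ∑ m, ξ (q.2 m) * ip (q.1 m) (v n)) :=
    measurable_posSup (measurable_pi_iff.2 fun n => by fun_prop)
  have h2 := hmp.lintegral_comp hm
  rw [lintegral_prod_symm' _ hm] at h2
  refine (le_of_eq h2).trans ?_
  change ∫⁻ s, ∫⁻ Φ, posSup (fun n => ∑ m, ξ (s m) * ip (Φ m) (v n)) ∂(matGauss M N)
    ∂(gaussVec M) ≤ _
  simp_rw [lintegral_posSup_weighted]
  rw [lintegral_mul_const _ (by unfold l2; fun_prop)]
  exact mul_le_mul_left (integral_l2_comp_le M hξ hξ2) _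

lemma lintegral_sq_sum_le {M N : ℕ} {p : Fin N → ℝ} (hp : ip p p = 1)
    {ζ : ℝ → ℝ} (hζ : Measurable ζ) (hζ2 : Integrable (fun t => ζ t ^ 2) stdGauss)
    (hζ0 : ∫ t, ζ t ∂stdGauss = 0) :
    ∫⁻ Φ, ENNReal.ofReal ((∑ m : Fin M, ζ (ip (Φ m) p)) ^ 2) ∂(matGauss M N) =
      ENNReal.ofReal (M * ∫ t, ζ t ^ 2 ∂stdGauss) := by
  have hmap : MeasurePreserving (fun g => ip g p) (gaussVec N) stdGauss := by
    refine ⟨by fun_prop, ?_⟩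
    have : l2 p = 1 := by
      rw [← sq_eq_sq₀ (l2_nonneg p) zero_le_one, l2_sq, hp, one_pow]
    simp_rw [fun g => ip_comm g p]
    rw [gaussVec_map_ip, this]
    simp
  have hL : MemLp ζ 2 stdGauss := (memLp_two_iff_integrable_sq hζ.aestronglyMeasurable).2 hζ2
  have hrow : MemLp (fun g => ζ (ip g p)) 2 (gaussVec N) := hL.comp_measurePreserving hmap
  have hrow0 : ∫ g, ζ (ip g p) ∂(gaussVec N) = 0 := by
    rw [← hζ0, ← hmap.map_eq, integral_map (by fun_prop) (by fun_prop)]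
  have hcoord : ∀ m : Fin M, MemLp (fun Φ : Fin M → Fin N → ℝ => ζ (ip (Φ m) p)) 2
      (matGauss M N) := fun m =>
    hrow.comp_measurePreserving (measurePreserving_eval (fun _ : Fin M => gaussVec N) m)
  have hsum : MemLp (fun Φ : Fin M → Fin N → ℝ => ∑ m, ζ (ip (Φ m) p)) 2 (matGauss M N) :=
    memLp_finsetSum _ fun m _ => hcoord m
  have hsum0 : ∫ Φ, ∑ m : Fin M, ζ (ip (Φ m) p) ∂(matGauss M N) = 0 := by
    rw [integral_finsetSum _ fun m _ => (hcoord m).integrable one_le_two]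
    refine Finset.sum_eq_zero fun m _ => ?_
    have h := (measurePreserving_eval (fun _ : Fin M => gaussVec N) m).map_eq
    rw [← hrow0, ← h, integral_map (measurable_pi_apply m).aemeasurable
      (Measurable.aestronglyMeasurable (by fun_prop))]
    rfl
  have hvar := variance_sum_pi (μ := fun _ : Fin M => gaussVec N)
    (X := fun _ g => ζ (ip g p)) fun _ => hrow
  rw [← matGauss_eq] at hvar
  rw [← ofReal_integral_eq_lintegral_ofReal hsum.integrable_sq (ae_of_all _ fun _ => sq_nonneg _)]
  congr 1
  have e : (∑ m : Fin M, fun Φ : Fin M → Fin N → ℝ => ζ (ip (Φ m) p)) =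
      fun Φ => ∑ m, ζ (ip (Φ m) p) := by ext Φ; simp
  rw [e, variance_of_integral_eq_zero hsum.aemeasurable hsum0] at hvar
  rw [hvar, variance_of_integral_eq_zero hrow.aemeasurable hrow0]
  simp only [Finset.sum_const, Finset.card_univ, Fintype.card_fin, nsmul_eq_mul]
  rw [← hmap.map_eq, integral_map (by fun_prop) (by fun_prop)]

lemma Quantizer.exists_mem_cell {Q : ℕ} (q : Quantizer Q) (t : ℝ) : ∃ i, t ∈ q.cell i := by
  obtain ⟨i, hi, hmax⟩ := Finset.exists_max_image
    (Finset.univ.filter fun i : Fin (Q + 1) => q.τ i ≤ (t : EReal)) id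
    ⟨0, by simp [q.τ_bot]⟩
  simp only [Finset.mem_filter, Finset.mem_univ, true_and, id] at hi hmax
  have hne : i ≠ Fin.last Q := by
    rintro rfl
    rw [q.τ_top] at hi
    exact EReal.coe_ne_top t (top_le_iff.1 hi)
  obtain ⟨j, rfl⟩ := Fin.exists_castSucc_eq.2 hne
  refine ⟨j, hi, ?_⟩
  by_contra! hle
  exact absurd (hmax j.succ hle) (not_le.2 (Fin.castSucc_lt_succ))

lemma Quantizer.f_eq_of_mem_cell {Q : ℕ} (q : Quantizer Q) {i : Fin Q} {t : ℝ}
    (ht : t ∈ q.cell i) : q.f t = q.m i := q.f_eq i t ht.1 ht.2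

lemma Quantizer.measurable_f {Q : ℕ} (q : Quantizer Q) : Measurable q.f := by
  intro s _
  have hcell : ∀ i, MeasurableSet (q.cell i) := fun i =>
    (measurableSet_le measurable_const measurable_coe_real_ereal).inter
      (measurableSet_lt measurable_coe_real_ereal measurable_const)
  have : q.f ⁻¹' s = ⋃ i ∈ {i | q.m i ∈ s}, q.cell i := by
    ext t
    simp only [Set.mem_preimage, Set.mem_iUnion, Set.mem_ofPred_eq, exists_prop]
    constructor
    · intro ht
      obtain ⟨i, hi⟩ := q.exists_mem_cell t
      exact ⟨i, q.f_eq_of_mem_cell hi ▸ ht, hi⟩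
    · rintro ⟨i, hs, hi⟩
      rwa [q.f_eq_of_mem_cell hi]
  rw [this]
  exact MeasurableSet.biUnion (Set.to_countable _) fun i _ => hcell i

lemma Quantizer.abs_f_le {Q : ℕ} (q : Quantizer Q) (t : ℝ) : |q.f t| ≤ ∑ i, |q.m i| := by
  obtain ⟨i, hi⟩ := q.exists_mem_cell t
  rw [q.f_eq_of_mem_cell hi]
  exact Finset.single_le_sum (f := fun i => |q.m i|) (fun _ _ => abs_nonneg _) (Finset.mem_univ i)

lemma integrable_even_pow_stdGauss (k : ℕ) : Integrable (fun t : ℝ => t ^ (2 * k)) stdGauss := by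
  have h := (memLp_id_gaussianReal (μ := 0) (v := 1) ((2 * k : ℕ) : NNReal)).integrable_norm_pow'
  simpa [Even.pow_abs, stdGauss] using h

lemma integral_sq_stdGauss : ∫ t, t ^ 2 ∂stdGauss = 1 := by
  have h : variance (fun t : ℝ => t) stdGauss = 1 := by
    rw [stdGauss, variance_fun_id_gaussianReal]; simp
  rwa [variance_of_integral_eq_zero aemeasurable_id' integral_id_stdGauss] at h

lemma sub_mul_sq_le {a b m t : ℝ} (h : |a| ≤ b) :
    (a - m * t) ^ 2 ≤ 2 * b ^ 2 + 2 * m ^ 2 * t ^ 2 := by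
  have : a ^ 2 ≤ b ^ 2 := sq_le_sq.2 (h.trans (le_abs_self b))
  nlinarith [sq_nonneg (a + m * t)]

lemma integrable_residual_sq {f : ℝ → ℝ} (hf : Measurable f) {b : ℝ} (hb : ∀ t, |f t| ≤ b)
    (m : ℝ) : Integrable (fun t => (f t - m * t) ^ 2) stdGauss := by
  refine Integrable.mono' ((integrable_const (2 * b ^ 2)).add
    ((integrable_even_pow_stdGauss 1).const_mul (2 * m ^ 2)))
    (Measurable.aestronglyMeasurable (by fun_prop)) (ae_of_all _ fun t => ?_)
  rw [Real.norm_of_nonneg (sq_nonneg _)]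
  simpa using sub_mul_sq_le (hb t)

lemma integrable_residual_mul_sq {f : ℝ → ℝ} (hf : Measurable f) {b : ℝ} (hb : ∀ t, |f t| ≤ b)
    (m : ℝ) : Integrable (fun t => ((f t - m * t) * t) ^ 2) stdGauss := by
  refine Integrable.mono' (((integrable_even_pow_stdGauss 1).const_mul (2 * b ^ 2)).add
    ((integrable_even_pow_stdGauss 2).const_mul (2 * m ^ 2)))
    (Measurable.aestronglyMeasurable (by fun_prop)) (ae_of_all _ fun t => ?_)
  rw [Real.norm_of_nonneg (sq_nonneg _)]
  have := mul_le_mul_of_nonneg_right (sub_mul_sq_le (m := m) (t := t) (hb t)) (sq_nonneg t)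
  exact (mul_pow _ _ 2).le.trans (this.trans (le_of_eq (by simp only [Pi.add_apply]; ring)))

lemma integral_residual_mul {f : ℝ → ℝ} (hf : Measurable f) {b : ℝ} (hb : ∀ t, |f t| ≤ b) :
    ∫ t, (f t - (∫ s, f s * s ∂stdGauss) * t) * t ∂stdGauss = 0 := by
  have h1 : Integrable (fun t => f t * t) stdGauss :=
    integrable_id_stdGauss.bdd_mul hf.aestronglyMeasurable (ae_of_all _ hb)
  have h2 : Integrable (fun t : ℝ => t ^ 2) stdGauss := integrable_even_pow_stdGauss 1
  simp_rw [sub_mul, mul_assoc, ← sq]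
  rw [integral_sub h1 (h2.const_mul _), integral_const_mul, integral_sq_stdGauss]
  simp

lemma exists_seq_dense_subset {N : ℕ} {T : Set (Fin N → ℝ)} (hT : T.Nonempty) :
    ∃ v : ℕ → Fin N → ℝ, (∀ n, v n ∈ T) ∧ T ⊆ closure (Set.range v) := by
  have := hT.to_subtype
  obtain ⟨w, hw⟩ := TopologicalSpace.exists_dense_seq T
  refine ⟨fun n => w n, fun n => (w n).2, fun z hz => ?_⟩
  have h := closure_subtype.1 (hw ⟨z, hz⟩)
  rwa [← Set.range_comp] at h

lemma meanWidth_nonneg {N : ℕ} {S : Set (Fin N → ℝ)} (h0 : (0 : Fin N → ℝ) ∈ S) :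
    0 ≤ meanWidth S := by
  refine integral_nonneg fun g => ?_
  refine Real.sSup_nonneg' ⟨0, ⟨0, ⟨h0, by simp [l2]⟩, by simp [ip]⟩, le_rfl⟩

lemma integrable_l2 (N : ℕ) : Integrable (fun g => l2 g) (gaussVec N) := by
  have hc : ∀ m : Fin N, Integrable (fun s : Fin N → ℝ => |s m|) (gaussVec N) := fun m =>
    ((measurePreserving_eval (fun _ : Fin N => stdGauss) m).integrable_comp_of_integrable
      integrable_id_stdGauss).abs
  refine Integrable.mono' (integrable_finsetSum Finset.univ fun m _ => hc m)
    continuous_l2.measurable.aestronglyMeasurable (ae_of_all _ fun g => ?_)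
  rw [Real.norm_of_nonneg (l2_nonneg g), l2]
  refine Real.sqrt_le_iff.2 ⟨by positivity, ?_⟩
  simpa using Finset.sum_sq_le_sq_sum_of_nonneg (s := Finset.univ) (f := fun m => |g m|)
    fun _ _ => abs_nonneg _

lemma seqWidth_le_meanWidth {N : ℕ} {S : Set (Fin N → ℝ)} (h0 : (0 : Fin N → ℝ) ∈ S)
    {v : ℕ → Fin N → ℝ} (hv : ∀ n, v n ∈ S ∩ {z | l2 z ≤ 1})
    (hd : S ∩ {z | l2 z ≤ 1} ⊆ closure (Set.range v)) :
    seqWidth v ≤ ENNReal.ofReal (meanWidth S) := by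
  set T := S ∩ {z : Fin N → ℝ | l2 z ≤ 1}
  have hT0 : (0 : Fin N → ℝ) ∈ T := ⟨h0, by simp [l2]⟩
  set h : (Fin N → ℝ) → ℝ := fun g => sSup ((fun z => ip z g) '' T) with hh
  have hle : ∀ g, ∀ z ∈ T, ip z g ≤ l2 g := fun g z hz =>
    (le_abs_self _).trans ((abs_ip_le z g).trans (mul_le_of_le_one_left (l2_nonneg g) hz.2))
  have hbdd : ∀ g, BddAbove ((fun z => ip z g) '' T) := fun g =>
    ⟨l2 g, by rintro _ ⟨z, hz, rfl⟩; exact hle g z hz⟩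
  have hne : ∀ g, ((fun z => ip z g) '' T).Nonempty := fun g => ⟨_, 0, hT0, rfl⟩
  have hnn : ∀ g, 0 ≤ h g := fun g => le_csSup (hbdd g) ⟨0, hT0, by simp [ip]⟩
  have hub : ∀ g, posSup (fun n => ip g (v n)) ≤ ENNReal.ofReal (h g) := fun g =>
    iSup_le fun n => ENNReal.ofReal_le_ofReal (le_csSup (hbdd g) ⟨v n, hv n, ip_comm _ _⟩)
  have htop : ∀ g, posSup (fun n => ip g (v n)) ≠ ⊤ := fun g =>
    ne_top_of_le_ne_top ENNReal.ofReal_ne_top (hub g)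
  have heq : h = fun g => (posSup fun n => ip g (v n)).toReal := by
    ext g
    refine le_antisymm (csSup_le (hne g) ?_) (ENNReal.toReal_le_of_le_ofReal (hnn g) (hub g))
    rintro _ ⟨z, hz, rfl⟩
    have hcl : IsClosed {z | ip z g ≤ (posSup fun n => ip g (v n)).toReal} :=
      isClosed_le (continuous_ip continuous_id continuous_const) continuous_const
    refine closure_minimal ?_ hcl (hd hz)
    rintro _ ⟨n, rfl⟩
    refine (ENNReal.ofReal_le_iff_le_toReal (htop g)).1 ?_
    rw [ip_comm]
    exact ofReal_le_posSup (fun n => ip g (v n)) n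
  have hmeas : Measurable h := by
    rw [heq]
    exact (measurable_posSup (measurable_ip_seq v)).ennreal_toReal
  have hint : Integrable h (gaussVec N) :=
    (integrable_l2 N).mono' hmeas.aestronglyMeasurable (ae_of_all _ fun g => by
      rw [Real.norm_of_nonneg (hnn g)]
      refine csSup_le (hne g) ?_
      rintro _ ⟨z, hz, rfl⟩
      exact hle g z hz)
  calc seqWidth v ≤ ∫⁻ g, ENNReal.ofReal (h g) ∂(gaussVec N) := lintegral_mono hub
    _ = ENNReal.ofReal (meanWidth S) :=
      (ofReal_integral_eq_lintegral_ofReal hint (ae_of_all _ hnn)).symm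

/-- Markov's inequality with a bound that is allowed to vanish. -/
lemma measure_gt_mul_le {Ω : Type*} [MeasurableSpace Ω] (μ : Measure Ω) {W : Ω → ENNReal}
    (hW : Measurable W) {t : ℝ} (ht : ∫⁻ ω, W ω ∂μ ≤ ENNReal.ofReal t)
    {A : ℝ} (hA : 0 < A) :
    μ {ω | ENNReal.ofReal (A * t) < W ω} ≤ ENNReal.ofReal A⁻¹ := by
  rcases le_or_gt t 0 with h0 | h0
  · rw [ENNReal.ofReal_of_nonpos h0, nonpos_iff_eq_zero, lintegral_eq_zero_iff hW] at ht
    refine le_of_eq_of_le ?_ zero_le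
    refine measure_mono_null (fun ω hω => ?_) (ae_iff.1 ht)
    exact ne_of_gt (lt_of_le_of_lt zero_le hω)
  · have hAt : 0 < A * t := mul_pos hA h0
    have hsub : {ω | ENNReal.ofReal (A * t) < W ω} ⊆ {ω | ENNReal.ofReal (A * t) ≤ W ω} := by
      intro ω hω
      rw [Set.mem_ofPred_eq] at hω ⊢
      exact hω.le
    refine (measure_mono hsub).trans ((meas_ge_le_lintegral_div hW.aemeasurable
      (ENNReal.ofReal_pos.2 hAt).ne' ENNReal.ofReal_ne_top).trans ?_)
    refine (ENNReal.div_le_div_right ht _).trans ?_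
    rw [← ENNReal.ofReal_div_of_pos hAt]
    refine ENNReal.ofReal_le_ofReal (le_of_eq ?_)
    field_simp

/-- The deterministic part: restricted injectivity and a noise bound on the tangent cone control
the error of any Lasso solution. -/
lemma lasso_error_le {M N : ℕ} (hM : 0 < M) {K : Set (Fin N → ℝ)} {u x' : Fin N → ℝ}
    {Φ : Fin M → Fin N → ℝ} {y : Fin M → ℝ} {κ R : ℝ} (hκ : 0 < κ) (hR : 0 ≤ R) (hu : u ∈ K)
    (hlow : ∀ v ∈ tangentCone K u ∩ {z | l2 z ≤ 1},
      ∑ m, (κ * l2 v - |ip (Φ m) v|) ≤ κ * M / 2)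
    (hnoise : ∀ v ∈ tangentCone K u ∩ {z | l2 z ≤ 1},
      ∑ m, (y m - ip (Φ m) u) * ip (Φ m) v ≤ R)
    (hx' : IsLassoSol K Φ y x') : l2 (x' - u) ≤ 8 * R / (κ ^ 2 * M) := by
  have hM' : (0 : ℝ) < M := Nat.cast_pos.2 hM
  by_cases hh : x' - u = 0
  · rw [hh]
    have : l2 (0 : Fin N → ℝ) = 0 := by simp [l2]
    rw [this]; positivity
  set r := l2 (x' - u) with hr
  have hrpos : 0 < r := l2_pos hh
  set v := r⁻¹ • (x' - u) with hvdef
  have hlv : l2 v = 1 := by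
    rw [hvdef, l2_smul, abs_of_pos (inv_pos.2 hrpos), ← hr, inv_mul_cancel₀ hrpos.ne']
  have hvT : v ∈ tangentCone K u ∩ {z | l2 z ≤ 1} :=
    ⟨⟨r⁻¹, (inv_pos.2 hrpos).le, x', hx'.1, rfl⟩, hlv.le⟩
  have h1 := hlow v hvT
  have h2 := hnoise v hvT
  rw [hlv, mul_one, Finset.sum_sub_distrib, Finset.sum_const, Finset.card_univ, Fintype.card_fin,
    nsmul_eq_mul] at h1
  have h3 : κ * M / 2 ≤ ∑ m, |ip (Φ m) v| := by linarith
  have h4 : (∑ m, |ip (Φ m) v|) ^ 2 ≤ M * ∑ m, ip (Φ m) v ^ 2 := by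
    simpa using sq_sum_le_card_mul_sum_sq (s := Finset.univ) (f := fun m => |ip (Φ m) v|)
  have h5 : (κ * M / 2) ^ 2 ≤ M * ∑ m, ip (Φ m) v ^ 2 :=
    (pow_le_pow_left₀ (by positivity) h3 2).trans h4
  have h6 := (Real.sqrt_le_sqrt_iff (by positivity)).1 (hx'.2 u hu)
  have e1 : ∀ m, (mulVec' Φ x' - y) m ^ 2 =
      r ^ 2 * ip (Φ m) v ^ 2 - 2 * r * ((y m - ip (Φ m) u) * ip (Φ m) v) +
        (mulVec' Φ u - y) m ^ 2 := by
    intro m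
    have hx : r * ip (Φ m) v = ip (Φ m) x' - ip (Φ m) u := by
      rw [hvdef, ip_smul_right, ← mul_assoc, mul_inv_cancel₀ hrpos.ne', one_mul, ip_sub_right]
    change (ip (Φ m) x' - y m) ^ 2 = _ + (ip (Φ m) u - y m) ^ 2
    rw [show ip (Φ m) x' = r * ip (Φ m) v + ip (Φ m) u by linarith]
    ring
  simp_rw [e1, Finset.sum_add_distrib, Finset.sum_sub_distrib, ← Finset.mul_sum] at h6
  have h7 : r * (r * ∑ m, ip (Φ m) v ^ 2) ≤ r * (2 * R) := by
    nlinarith [mul_le_mul_of_nonneg_left h2 hrpos.le]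
  have h8 : r * ∑ m, ip (Φ m) v ^ 2 ≤ 2 * R := le_of_mul_le_mul_left h7 hrpos
  rw [le_div_iff₀ (by positivity)]
  have h9 : r * (κ * M / 2) ^ 2 ≤ M * (2 * R) := by
    nlinarith [mul_le_mul_of_nonneg_left h5 hrpos.le, mul_le_mul_of_nonneg_left h8 hM'.le]
  refine le_of_mul_le_mul_left ?_ hM'
  nlinarith

/-- K-Lasso recovery bound for an arbitrary quantizer applied to a signal of
arbitrary (nonzero) norm, with the scaling `μ_p`, `σ_p`, `η_p` computed at `‖x‖₂`. -/
theorem lasso_general_norm_bound :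
    ∃ c C : ℝ, 0 < c ∧ 0 < C ∧
      ∀ (N M Q : ℕ), 0 < N → 0 < M → 2 ≤ Q →
      ∀ K : Set (Fin N → ℝ), IsClosed K →
      ∀ q : Quantizer Q,
      ∀ x : Fin N → ℝ, x ≠ 0 →
      ∀ μp : ℝ, μp = ∫ t, q.f (l2 x * t) * t ∂stdGauss →
      ∀ σp : ℝ, σp = Real.sqrt (∫ t, (q.f (l2 x * t) - μp * t) ^ 2 ∂stdGauss) →
      ∀ ηp : ℝ, ηp = Real.sqrt (∫ t, (q.f (l2 x * t) - μp * t) ^ 2 * t ^ 2 ∂stdGauss) →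
      (μp / l2 x) • x ∈ K →
      ∀ d : ℝ, d = meanWidth (tangentCone K ((μp / l2 x) • x)) ^ 2 →
      c * d ≤ (M : ℝ) →
      ENNReal.ofReal 0.99 ≤
        matGauss M N {Φ | ∀ x' : Fin N → ℝ,
          IsLassoSol K Φ (fun i => q.f (mulVec' Φ x i)) x' →
          l2 (x' - (μp / l2 x) • x) ≤
            C * (Real.sqrt d * σp + ηp) / Real.sqrt M} := by
  set κ : ℝ := ∫ t, |t| ∂stdGauss with hκdef
  have hκ : 0 < κ := integral_abs_stdGauss_pos
  refine ⟨(4000 / κ) ^ 2, 8000 / κ ^ 2, by positivity, by positivity, ?_⟩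
  intro N M Q _ hM _ K _ q x hx μp hμ σp hσ ηp hη huK d hd hcd
  have hM' : (0 : ℝ) < M := Nat.cast_pos.2 hM
  have hlx := l2_pos hx
  set p : Fin N → ℝ := (l2 x)⁻¹ • x with hpdef
  have hp : ip p p = 1 := by
    rw [hpdef, ip_smul_left, ip_smul_right, ← l2_sq]
    field_simp
  have hxp : x = l2 x • p := by rw [hpdef, smul_inv_smul₀ hlx.ne']
  set u := (μp / l2 x) • x with hudef
  have hup : u = μp • p := by rw [hudef, hpdef, smul_smul, div_eq_mul_inv]
  set w := meanWidth (tangentCone K u) with hw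
  have h0 : (0 : Fin N → ℝ) ∈ tangentCone K u := ⟨0, le_rfl, u, huK, by simp⟩
  have hw0 : 0 ≤ w := meanWidth_nonneg h0
  have hsd : Real.sqrt d = w := by rw [hd, Real.sqrt_sq hw0]
  set T := tangentCone K u ∩ {z | l2 z ≤ 1}
  obtain ⟨v, hvT, hvd⟩ := exists_seq_dense_subset (T := T) ⟨0, h0, by simp [l2]⟩
  have hW := seqWidth_le_meanWidth h0 hvT hvd
  set f : ℝ → ℝ := fun t => q.f (l2 x * t) with hf
  have hfm : Measurable f := q.measurable_f.comp (measurable_const_mul _)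
  have hfb : ∀ t, |f t| ≤ ∑ i, |q.m i| := fun t => q.abs_f_le _
  set ξ : ℝ → ℝ := fun t => f t - μp * t with hξ
  have hξm : Measurable ξ := by fun_prop
  have hζm : Measurable fun t => ξ t * t := by fun_prop
  have hξ2 : Integrable (fun t => ξ t ^ 2) stdGauss := integrable_residual_sq hfm hfb μp
  have hζ2 : Integrable (fun t => (ξ t * t) ^ 2) stdGauss :=
    integrable_residual_mul_sq hfm hfb μp
  have hζ0 : ∫ t, ξ t * t ∂stdGauss = 0 := by
    simp only [hξ, hμ]
    exact integral_residual_mul hfm hfb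
  have hσ0 : 0 ≤ σp := hσ ▸ Real.sqrt_nonneg _
  have hη0 : 0 ≤ ηp := hη ▸ Real.sqrt_nonneg _
  have hσ' : Real.sqrt (∫ t, ξ t ^ 2 ∂stdGauss) = σp := hσ.symm
  have hη' : ∫ t, (ξ t * t) ^ 2 ∂stdGauss = ηp ^ 2 := by
    rw [hη, Real.sq_sqrt (integral_nonneg fun t => by positivity)]
    simp only [mul_pow, hξ, hf]
  set s := Real.sqrt M with hs
  have hs0 : 0 < s := Real.sqrt_pos.2 hM'
  have hss : s * s = M := Real.mul_self_sqrt hM'.le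
  have hwM : 4000 * w ≤ κ * s := by
    have h : (4000 / κ * w) ^ 2 ≤ s ^ 2 := by rw [sq s, hss, mul_pow, ← hd]; exact hcd
    have h' := (sq_le_sq₀ (by positivity) hs0.le).1 h
    rw [div_mul_eq_mul_div, div_le_iff₀ hκ] at h'
    linarith
  set W₁ : (Fin M → Fin N → ℝ) → ENNReal := fun Φ =>
    posSup fun n => ∑ m, (κ * l2 (v n) - |ip (Φ m) (v n)|) with hW₁
  set W₂ : (Fin M → Fin N → ℝ) → ENNReal := fun Φ =>
    posSup fun n => ∑ m, ξ (ip (Φ m) p) * (ip (Φ m) (v n) - ip (Φ m) p * ip p (v n)) with hW₂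
  set W₃ : (Fin M → Fin N → ℝ) → ENNReal := fun Φ =>
    ENNReal.ofReal ((∑ m, ξ (ip (Φ m) p) * ip (Φ m) p) ^ 2) with hW₃
  have b₁ := measure_gt_mul_le (matGauss M N) (W := W₁) (t := 2 * s * w)
    (measurable_posSup (measurable_pi_iff.2 fun n => by fun_prop))
    (by
      refine (lintegral_posSup_lower v).trans ?_
      rw [ENNReal.ofReal_mul (p := 2 * s) (q := w) (by positivity)]
      exact mul_le_mul_right hW _) (A := 1000) (by norm_num)
  have b₂ := measure_gt_mul_le (matGauss M N) (W := W₂) (t := s * σp * w)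
    (measurable_posSup (measurable_pi_iff.2 fun n => by fun_prop))
    (by
      refine (lintegral_posSup_noise v hp hξm hξ2).trans ?_
      rw [hσ', ENNReal.ofReal_mul (p := s * σp) (q := w) (by positivity)]
      exact mul_le_mul_right hW _) (A := 1000) (by norm_num)
  have b₃ := measure_gt_mul_le (matGauss M N) (W := W₃) (t := M * ηp ^ 2)
    (by fun_prop)
    (by
      rw [← hη']
      exact (lintegral_sq_sum_le hp hζm hζ2 hζ0).le) (A := 1000) (by norm_num)
  rw [hsd]
  set S : Set (Fin M → Fin N → ℝ) := {Φ | ∀ x' : Fin N → ℝ,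
    IsLassoSol K Φ (fun i => q.f (mulVec' Φ x i)) x' →
      l2 (x' - u) ≤ 8000 / κ ^ 2 * (w * σp + ηp) / s} with hS
  have hgood : ∀ Φ, W₁ Φ ≤ ENNReal.ofReal (1000 * (2 * s * w)) →
      W₂ Φ ≤ ENNReal.ofReal (1000 * (s * σp * w)) →
      W₃ Φ ≤ ENNReal.ofReal (1000 * (M * ηp ^ 2)) → Φ ∈ S := by
    intro Φ g₁ g₂ g₃ x' hx'
    have l₁ : ∀ z ∈ T, ∑ m, (κ * l2 z - |ip (Φ m) z|) ≤ κ * M / 2 := by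
      intro z hz
      have hcl : IsClosed {z | ∑ m, (κ * l2 z - |ip (Φ m) z|) ≤ κ * M / 2} :=
        isClosed_le (continuous_finsetSum _ fun m _ => (continuous_l2.const_mul κ).sub
          (continuous_ip continuous_const continuous_id).abs) continuous_const
      refine closure_minimal ?_ hcl (hvd hz)
      rintro _ ⟨n, rfl⟩
      have h := (ENNReal.ofReal_le_ofReal_iff (by positivity)).1
        ((ofReal_le_posSup _ n).trans g₁)
      refine h.trans ?_
      rw [← hss]
      nlinarith [mul_le_mul_of_nonneg_right hwM hs0.le]
    have l₂ : ∀ z ∈ T, ∑ m, ξ (ip (Φ m) p) * (ip (Φ m) z - ip (Φ m) p * ip p z) ≤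
        1000 * (s * σp * w) := by
      intro z hz
      have hcl : IsClosed {z | ∑ m, ξ (ip (Φ m) p) * (ip (Φ m) z - ip (Φ m) p * ip p z) ≤
          1000 * (s * σp * w)} :=
        isClosed_le (continuous_finsetSum _ fun m _ => continuous_const.mul
          ((continuous_ip continuous_const continuous_id).sub
            (continuous_const.mul (continuous_ip continuous_const continuous_id))))
          continuous_const
      refine closure_minimal ?_ hcl (hvd hz)
      rintro _ ⟨n, rfl⟩
      exact (ENNReal.ofReal_le_ofReal_iff (by positivity)).1 ((ofReal_le_posSup _ n).trans g₂)
    have l₃ : |∑ m, ξ (ip (Φ m) p) * ip (Φ m) p| ≤ 1000 * (s * ηp) := by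
      have h := (ENNReal.ofReal_le_ofReal_iff (by positivity)).1 g₃
      refine abs_le_of_sq_le_sq (h.trans ?_) (by positivity)
      rw [← hss]
      nlinarith [sq_nonneg (s * ηp)]
    have hres : ∀ m, q.f (mulVec' Φ x m) - ip (Φ m) u = ξ (ip (Φ m) p) := by
      intro m
      change q.f (ip (Φ m) x) - ip (Φ m) u = q.f (l2 x * ip (Φ m) p) - μp * ip (Φ m) p
      rw [← ip_smul_right, ← hxp, hup, ip_smul_right]
    have lp : l2 p = 1 := by
      rw [← sq_eq_sq₀ (l2_nonneg p) zero_le_one, l2_sq, hp, one_pow]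
    have l₄ : ∀ z ∈ T, ∑ m, (q.f (mulVec' Φ x m) - ip (Φ m) u) * ip (Φ m) z ≤
        1000 * s * (w * σp + ηp) := by
      intro z hz
      have hip : |ip p z| ≤ 1 := (abs_ip_le p z).trans (by rw [lp, one_mul]; exact hz.2)
      have e : ∑ m, (q.f (mulVec' Φ x m) - ip (Φ m) u) * ip (Φ m) z =
          ∑ m, ξ (ip (Φ m) p) * (ip (Φ m) z - ip (Φ m) p * ip p z) +
            ip p z * ∑ m, ξ (ip (Φ m) p) * ip (Φ m) p := by
        rw [Finset.mul_sum, ← Finset.sum_add_distrib]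
        exact Finset.sum_congr rfl fun m _ => by rw [hres]; ring
      have h : ip p z * ∑ m, ξ (ip (Φ m) p) * ip (Φ m) p ≤ 1000 * (s * ηp) := by
        refine (le_abs_self _).trans ?_
        rw [abs_mul]
        exact (mul_le_of_le_one_left (abs_nonneg _) hip).trans l₃
      rw [e]
      linarith [l₂ z hz]
    refine (lasso_error_le hM hκ (R := 1000 * s * (w * σp + ηp)) (by positivity) huK l₁ l₄
      hx').trans (le_of_eq ?_)
    rw [← hss]
    field_simp
    ring
  have hcover : (univ : Set (Fin M → Fin N → ℝ)) ⊆
      S ∪ ({Φ | ENNReal.ofReal (1000 * (2 * s * w)) < W₁ Φ} ∪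
        ({Φ | ENNReal.ofReal (1000 * (s * σp * w)) < W₂ Φ} ∪
          {Φ | ENNReal.ofReal (1000 * (M * ηp ^ 2)) < W₃ Φ})) := by
    intro Φ _
    by_contra hΦ
    simp only [Set.mem_union, Set.mem_ofPred_eq, not_or, not_lt] at hΦ
    exact hΦ.1 (hgood Φ hΦ.2.1 hΦ.2.2.1 hΦ.2.2.2)
  have htotal : (1 : ENNReal) ≤ matGauss M N S + ENNReal.ofReal (3 / 1000) := by
    rw [← measure_univ (μ := matGauss M N)]
    refine (measure_mono hcover).trans ((measure_union_le _ _).trans ?_)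
    gcongr
    refine ((measure_union_le _ _).trans
      (add_le_add b₁ ((measure_union_le _ _).trans (add_le_add b₂ b₃)))).trans (le_of_eq ?_)
    rw [← ENNReal.ofReal_add (by norm_num) (by norm_num),
      ← ENNReal.ofReal_add (by norm_num) (by norm_num)]
    norm_num
  refine le_trans ?_ (tsub_le_iff_right.2 htotal)
  rw [← ENNReal.ofReal_one, ← ENNReal.ofReal_sub _ (by norm_num)]
  exact ENNReal.ofReal_le_ofReal (by norm_num)
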